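/- Let X be a complete connected median space of rank n and let a, b ∈ X with a ≠ b. Then for every ε with 0 < ε ≤ d(a,b)/n, there exist k ≤ n pairwise transverse halfspaces h₁, …, h_k of X, each containing b and not a, such that for all i ∈ {1,…,k}: d(hᵢᶜ, b) ≥ ε, and moreover d(a, ⋂_{i=1}^k hᵢ) ≥ d(a,b) − (n(n+1)/2)·ε. -/

import Mathlib

/-- The interval `[a,b]` in a metric space: points `x` with `d(a,x) + d(x,b) = d(a,b)`. -/
def mInterval {X : Type*} [MetricSpace X] (a b : X) : Set X :=
  {x : X | dist a x + dist x b = dist a b}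

/-- A median space: every triple of points has a unique median point. -/
def IsMedianSpace (X : Type*) [MetricSpace X] : Prop :=
  ∀ a b c : X, ∃! m : X,
    m ∈ mInterval a b ∩ mInterval b c ∩ mInterval a c

/-- A subset is (median) convex if it contains the interval between any two of its points. -/
def MConvex {X : Type*} [MetricSpace X] (C : Set X) : Prop :=
  ∀ a ∈ C, ∀ b ∈ C, mInterval a b ⊆ C

/-- A halfspace: a convex subset with convex complement. -/
def IsHalfspace {X : Type*} [MetricSpace X] (h : Set X) : Prop :=
  MConvex h ∧ MConvex hᶜ

/-- Two subsets are transverse if the four pairwise intersections of them and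
their complements are all nonempty. -/
def TransverseSets {X : Type*} (h₁ h₂ : Set X) : Prop :=
  (h₁ ∩ h₂).Nonempty ∧ (h₁ᶜ ∩ h₂).Nonempty ∧ (h₁ ∩ h₂ᶜ).Nonempty ∧ (h₁ᶜ ∩ h₂ᶜ).Nonempty

/-- `X` has rank `n`: there are `n` pairwise transverse halfspaces but not `n+1`. -/
def HasMedianRank (X : Type*) [MetricSpace X] (n : ℕ) : Prop :=
  (∃ h : Fin n → Set X, (∀ i, IsHalfspace (h i)) ∧
    ∀ i j, i ≠ j → TransverseSets (h i) (h j)) ∧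
  ¬ ∃ h : Fin (n + 1) → Set X, (∀ i, IsHalfspace (h i)) ∧
    ∀ i j, i ≠ j → TransverseSets (h i) (h j)

/-- Median convex hull: intersection of all convex subsets containing `A`. -/
def mConvexHull {X : Type*} [MetricSpace X] (A : Set X) : Set X :=
  ⋂₀ {C : Set X | MConvex C ∧ A ⊆ C}

/-- The hyperplane bounding a halfspace `h`. -/
def mHyperplane {X : Type*} [MetricSpace X] (h : Set X) : Set X :=
  closure h ∩ closure hᶜ

/-- Depth of the halfspace `h` in the subset `A`:
`sup { d(x, ĥ) | x ∈ h ∩ A }`. -/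
noncomputable def mDepth {X : Type*} [MetricSpace X] (A h : Set X) : ℝ :=
  sSup ((fun x => Metric.infDist x (mHyperplane h)) '' (h ∩ A))

/-- `π` is the nearest-point projection onto `C`. -/
def IsNearestPointProj {X : Type*} [MetricSpace X] (C : Set X) (π : X → X) : Prop :=
  ∀ x : X, π x ∈ C ∧ dist x (π x) = Metric.infDist x C

/-- The halfspace `h` separates the points `x` and `y`. -/
def SeparatesPts {X : Type*} (h : Set X) (x y : X) : Prop :=
  (x ∈ h ∧ y ∈ hᶜ) ∨ (y ∈ h ∧ x ∈ hᶜ)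

theorem dilworth_finset {α : Type*} [PartialOrder α] :
    ∀ (N : ℕ) (s : Finset α) (n : ℕ), s.card ≤ N →
    (∀ t ⊆ s, IsAntichain (· ≤ ·) (t : Set α) → t.card ≤ n) →
    ∃ c : α → ℕ, (∀ x ∈ s, c x < n) ∧
      ∀ x ∈ s, ∀ y ∈ s, c x = c y → x ≤ y ∨ y ≤ x := by
  classical
  intro N
  induction N with
  | zero =>
    intro s n hs _
    have : s = ∅ := by simpa using hs
    subst this
    exact ⟨fun _ => 0, by simp, by simp⟩
  | succ N ih =>
    intro s n hs hw
    rcases s.eq_empty_or_nonempty with rfl | hne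
    · exact ⟨fun _ => 0, by simp, by simp⟩
    obtain ⟨m, hm⟩ := s.exists_maximal hne
    have hms : m ∈ s := hm.1
    have hn1 : 1 ≤ n := by
      have := hw {m} (by simpa using hms) (by simp)
      simpa using this
    -- extension of a coloring by one chain
    have key : ∀ K ⊆ s, m ∈ K → (∀ x ∈ K, ∀ y ∈ K, x ≤ y ∨ y ≤ x) →
        (∀ t ⊆ s \ K, IsAntichain (· ≤ ·) (t : Set α) → t.card ≤ n - 1) →
        ∃ c : α → ℕ, (∀ x ∈ s, c x < n) ∧
          ∀ x ∈ s, ∀ y ∈ s, c x = c y → x ≤ y ∨ y ≤ x := by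
      intro K hK hmK hchain hwK
      have hcard : (s \ K).card ≤ N := by
        have : (s \ K).card < s.card := by
          apply Finset.card_lt_card
          refine ⟨Finset.sdiff_subset, fun h => ?_⟩
          have := h hms
          simp [hmK] at this
        omega
      obtain ⟨c, hc1, hc2⟩ := ih (s \ K) (n - 1) hcard hwK
      refine ⟨fun x => if x ∈ K then n - 1 else c x, ?_, ?_⟩
      · intro x hx
        by_cases hxK : x ∈ K
        · simp [hxK]; omega
        · have := hc1 x (by simp [hx, hxK])
          simp [hxK]; omega
      · intro x hx y hy hxy
        by_cases hxK : x ∈ K <;> by_cases hyK : y ∈ K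
        · exact hchain x hxK y hyK
        · have := hc1 y (by simp [hy, hyK])
          simp [hxK, hyK] at hxy; omega
        · have := hc1 x (by simp [hx, hxK])
          simp [hxK, hyK] at hxy; omega
        · simp [hxK, hyK] at hxy
          exact hc2 x (by simp [hx, hxK]) y (by simp [hy, hyK]) hxy
    set s' := s \ {m} with hs'
    have hs's : s' ⊆ s := Finset.sdiff_subset
    by_cases hsmall : ∀ t ⊆ s', IsAntichain (· ≤ ·) (t : Set α) → t.card ≤ n - 1
    · exact key {m} (by simpa using hms) (by simp) (by simp) hsmall
    push Not at hsmall
    obtain ⟨A0, hA0s, hA0, hA0c⟩ := hsmall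
    have hA0n : A0.card = n := by
      have := hw A0 (hA0s.trans hs's) hA0
      omega
    have hcard' : s'.card ≤ N := by
      have : s'.card < s.card := by
        apply Finset.card_lt_card
        refine ⟨hs's, fun h => ?_⟩
        have := h hms
        simp [hs'] at this
      omega
    obtain ⟨c, hc1, hc2⟩ := ih s' n hcard' (fun t ht => hw t (ht.trans hs's))
    have hit : ∀ B ⊆ s', IsAntichain (· ≤ ·) (B : Set α) → B.card = n →
        ∀ i < n, ∃ y ∈ B, c y = i := by
      intro B hB hBa hBn i hi
      have hinj : Set.InjOn c B := by
        intro x hx y hy hxy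
        rcases hc2 x (hB hx) y (hB hy) hxy with h | h
        · exact hBa.eq hx hy h
        · exact (hBa.eq hy hx h).symm
      have himg : B.image c = Finset.range n := by
        apply Finset.eq_of_subset_of_card_le
        · intro j hj
          obtain ⟨x, hx, rfl⟩ := Finset.mem_image.1 hj
          exact Finset.mem_range.2 (hc1 x (hB hx))
        · rw [Finset.card_image_of_injOn hinj, hBn, Finset.card_range]
      have : i ∈ B.image c := by rw [himg]; simpa using hi
      simpa using this
    let Z : ℕ → Finset α := fun i => s'.filter (fun z => c z = i ∧
      ∃ B ⊆ s', IsAntichain (· ≤ ·) (B : Set α) ∧ B.card = n ∧ z ∈ B)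
    have hZ : ∀ i z, z ∈ Z i ↔ z ∈ s' ∧ c z = i ∧
      ∃ B ⊆ s', IsAntichain (· ≤ ·) (B : Set α) ∧ B.card = n ∧ z ∈ B := by
      intro i z; simp only [Z, Finset.mem_filter]
    have hgr : ∀ i, ∃ x, i < n → x ∈ Z i ∧ ∀ y ∈ Z i, y ≤ x := by
      intro i
      by_cases hi : i < n
      · obtain ⟨y, hy, hyi⟩ := hit A0 hA0s hA0 hA0n i hi
        have hyZ : y ∈ Z i := (hZ i y).2 ⟨hA0s hy, hyi, A0, hA0s, hA0, hA0n, hy⟩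
        obtain ⟨x, hx⟩ := (Z i).exists_maximal ⟨y, hyZ⟩
        refine ⟨x, fun _ => ⟨hx.1, fun w hw' => ?_⟩⟩
        have h1 := (hZ i w).1 hw'
        have h2 := (hZ i x).1 hx.1
        rcases hc2 w h1.1 x h2.1 (h1.2.1.trans h2.2.1.symm) with h | h
        · exact h
        · exact hx.2 hw' h
      · exact ⟨m, fun h => absurd h hi⟩
    choose x hx using hgr
    have hxle : ∀ i < n, ∀ j < n, x i ≤ x j → i = j := by
      intro i hi j hj hij
      obtain ⟨_, hcj, B, hBs, hBa, hBn, hxB⟩ := (hZ j _).1 (hx j hj).1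
      obtain ⟨y, hyB, hyi⟩ := hit B hBs hBa hBn i hi
      have hyZ : y ∈ Z i := (hZ i y).2 ⟨hBs hyB, hyi, B, hBs, hBa, hBn, hyB⟩
      have := hBa.eq hyB hxB (((hx i hi).2 y hyZ).trans hij)
      rw [← hyi, this, hcj]
    have hxs : ∀ i < n, x i ∈ s' := fun i hi => ((hZ i _).1 (hx i hi).1).1
    have hex : ∃ i < n, x i ≤ m := by
      by_contra hcon
      push Not at hcon
      let A := insert m ((Finset.range n).image x)
      have hmA : m ∉ (Finset.range n).image x := by
        intro h
        obtain ⟨i, hi, he⟩ := Finset.mem_image.1 h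
        exact hcon i (by simpa using hi) he.le
      have hAcard : A.card = n + 1 := by
        rw [Finset.card_insert_of_notMem hmA, Finset.card_image_of_injOn, Finset.card_range]
        intro i hi j hj hij
        exact hxle i (by simpa using hi) j (by simpa using hj) hij.le
      have hAs : A ⊆ s := by
        intro z hz
        rcases Finset.mem_insert.1 hz with rfl | hz
        · exact hms
        · obtain ⟨i, hi, rfl⟩ := Finset.mem_image.1 hz
          exact hs's (hxs i (by simpa using hi))
      have hAa : IsAntichain (· ≤ ·) (A : Set α) := by
        intro u hu v hv huv hle
        rcases Finset.mem_insert.1 hu with rfl | hu' <;>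
          rcases Finset.mem_insert.1 hv with rfl | hv'
        · exact huv rfl
        · exact huv (le_antisymm hle (hm.2 (hAs hv) hle))
        · obtain ⟨i, hi, rfl⟩ := Finset.mem_image.1 hu'
          exact hcon i (by simpa using hi) hle
        · obtain ⟨i, hi, rfl⟩ := Finset.mem_image.1 hu'
          obtain ⟨j, hj, rfl⟩ := Finset.mem_image.1 hv'
          exact huv (by rw [hxle i (by simpa using hi) j (by simpa using hj) hle])
      have := hw A hAs hAa
      omega
    obtain ⟨i, hi, him⟩ := hex
    apply key (insert m (s'.filter (fun z => c z = i ∧ z ≤ x i)))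
    · intro z hz
      rcases Finset.mem_insert.1 hz with rfl | hz
      · exact hms
      · exact hs's (Finset.mem_filter.1 hz).1
    · simp
    · intro u hu v hv
      rcases Finset.mem_insert.1 hu with rfl | hu' <;>
        rcases Finset.mem_insert.1 hv with rfl | hv'
      · exact Or.inl le_rfl
      · exact Or.inr ((Finset.mem_filter.1 hv').2.2.trans him)
      · exact Or.inl ((Finset.mem_filter.1 hu').2.2.trans him)
      · have h1 := Finset.mem_filter.1 hu'
        have h2 := Finset.mem_filter.1 hv'
        exact hc2 u h1.1 v h2.1 (h1.2.1.trans h2.2.1.symm)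
    · intro t ht hta
      by_contra hcon
      have htn : t.card = n := by
        have := hw t (ht.trans Finset.sdiff_subset) hta
        omega
      have hts' : t ⊆ s' := by
        intro z hz
        have := ht hz
        simp only [Finset.mem_sdiff, Finset.mem_insert, not_or] at this
        simp [hs', this.1, this.2.1]
      obtain ⟨y, hyt, hyi⟩ := hit t hts' hta htn i hi
      have hyZ : y ∈ Z i := (hZ i y).2 ⟨hts' hyt, hyi, t, hts', hta, htn, hyt⟩
      have hyx := (hx i hi).2 y hyZ
      have := ht hyt
      simp only [Finset.mem_sdiff, Finset.mem_insert, not_or, Finset.mem_filter] at this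
      exact this.2.2 ⟨hts' hyt, hyi, hyx⟩

theorem dilworth_infinite {α : Type*} [PartialOrder α] (n : ℕ)
    (hw : ∀ t : Finset α, IsAntichain (· ≤ ·) (t : Set α) → t.card ≤ n) :
    ∃ c : α → Fin n, ∀ x y, c x = c y → x ≤ y ∨ y ≤ x := by
  classical
  rcases isEmpty_or_nonempty α with he | ⟨⟨x0⟩⟩
  · exact ⟨fun x => he.elim x, fun x => he.elim x⟩
  have hn : 0 < n := by
    have := hw {x0} (by simp)
    rw [Finset.card_singleton] at this
    omega
  have : ∀ s : Finset α, ∃ c : α → Fin n, ∀ x ∈ s, ∀ y ∈ s, c x = c y → x ≤ y ∨ y ≤ x := by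
    intro s
    obtain ⟨c, hc1, hc2⟩ := dilworth_finset s.card s n le_rfl (fun t _ => hw t)
    refine ⟨fun x => ⟨c x % n, Nat.mod_lt _ hn⟩, fun x hx y hy hxy => hc2 x hx y hy ?_⟩
    have := congrArg Fin.val hxy
    simpa [Nat.mod_eq_of_lt (hc1 x hx), Nat.mod_eq_of_lt (hc1 y hy)] using this
  choose g hg using this
  obtain ⟨c, hc⟩ := Finset.rado_selection (β := fun _ : α => Fin n) g
  refine ⟨c, fun x y hxy => ?_⟩
  obtain ⟨t, hst, ht⟩ := hc {x, y}
  apply hg t x (hst (by simp)) y (hst (by simp))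
  rw [← ht x (by simp), ← ht y (by simp), hxy]

/-! ### Metric betweenness -/

section Median

variable {X : Type*} [MetricSpace X]

theorem mI_iff {a b x : X} : x ∈ mInterval a b ↔ dist a x + dist x b = dist a b := Iff.rfl

theorem mI_symm {a b x : X} (h : x ∈ mInterval a b) : x ∈ mInterval b a := by
  rw [mI_iff] at *
  rw [dist_comm b x, dist_comm x a, dist_comm b a]; linarith

theorem mI_left (a b : X) : a ∈ mInterval a b := by simp [mI_iff]

theorem mI_right (a b : X) : b ∈ mInterval a b := by simp [mI_iff]

/-- `a,y,x` and `a,x,b` geodesic: then `a,y,b` geodesic. -/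
theorem mI_trans {a b x y : X} (hx : x ∈ mInterval a b) (hy : y ∈ mInterval a x) :
    y ∈ mInterval a b := by
  rw [mI_iff] at *
  linarith [dist_triangle a y b, dist_triangle y x b]

/-- `a,y,x` and `a,x,b` geodesic: then `y,x,b` geodesic. -/
theorem mI_trans' {a b x y : X} (hx : x ∈ mInterval a b) (hy : y ∈ mInterval a x) :
    x ∈ mInterval y b := by
  rw [mI_iff] at *
  linarith [dist_triangle a y b, dist_triangle y x b]

theorem mI_eq {a b x : X} (h : x ∈ mInterval a b) (h' : b ∈ mInterval a x) : x = b := by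
  rw [mI_iff] at *
  have := dist_nonneg (x := x) (y := b)
  rw [dist_comm b x] at h'
  exact dist_le_zero.1 (by linarith)

theorem med_exists (hmed : IsMedianSpace X) (a b c : X) : ∃ m, m ∈ mInterval a b ∧ m ∈ mInterval b c ∧ m ∈ mInterval a c := by
  obtain ⟨m, hm, _⟩ := hmed a b c
  exact ⟨m, hm.1.1, hm.1.2, hm.2⟩

theorem med_unique (hmed : IsMedianSpace X) {a b c m m' : X} (h1 : m ∈ mInterval a b) (h2 : m ∈ mInterval b c)
    (h3 : m ∈ mInterval a c) (h1' : m' ∈ mInterval a b) (h2' : m' ∈ mInterval b c)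
    (h3' : m' ∈ mInterval a c) : m = m' :=
  (hmed a b c).unique ⟨⟨h1, h2⟩, h3⟩ ⟨⟨h1', h2'⟩, h3'⟩

/-- The fourth corner of a rectangle is unique. -/
theorem corner_unique (hmed : IsMedianSpace X) {p u s z w : X}
    (hz : z ∈ mInterval u s) (hw : w ∈ mInterval u s)
    (huz : u ∈ mInterval p z) (huw : u ∈ mInterval p w)
    (hsz : s ∈ mInterval p z) (hsw : s ∈ mInterval p w) : z = w := by
  obtain ⟨k, k1, k2, k3⟩ := med_exists hmed p z w
  obtain ⟨u', u1, u2, u3⟩ := med_exists hmed u z w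
  obtain ⟨s', s1, s2, s3⟩ := med_exists hmed s z w
  have eu : u' = k := med_unique hmed (a := p) (b := z) (c := w)
    (mI_symm (mI_trans (mI_symm huz) (mI_symm u1))) u2
    (mI_symm (mI_trans (mI_symm huw) (mI_symm u3))) k1 k2 k3
  have es : s' = k := med_unique hmed (a := p) (b := z) (c := w)
    (mI_symm (mI_trans (mI_symm hsz) (mI_symm s1))) s2
    (mI_symm (mI_trans (mI_symm hsw) (mI_symm s3))) k1 k2 k3
  subst eu
  subst es
  have hkz : s' = z := by
    have h := mI_trans' hz u1
    exact mI_eq s1 (mI_symm h)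
  have hkw : s' = w := by
    have h := mI_trans' hw u3
    exact mI_eq s3 (mI_symm h)
  exact hkz.symm.trans hkw

/-- In a rectangle `x,p,y,q`, the interval of one diagonal is in the interval of the other. -/
theorem rectangle_sub (hmed : IsMedianSpace X) {x p y q z : X}
    (hp : p ∈ mInterval x y) (hq : q ∈ mInterval x y)
    (hx : x ∈ mInterval p q) (hy : y ∈ mInterval p q)
    (hz : z ∈ mInterval x y) : z ∈ mInterval p q := by
  obtain ⟨u, u1, u2, u3⟩ := med_exists hmed x p z
  obtain ⟨w, w1, w2, w3⟩ := med_exists hmed u y q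
  obtain ⟨s, s1, s2, s3⟩ := med_exists hmed p y z
  obtain ⟨r, r1, r2, r3⟩ := med_exists hmed s u w
  rw [mI_iff] at *
  have c1 := dist_comm x p
  have c2 := dist_comm y q
  have c3 := dist_comm p u
  have c4 := dist_comm z u
  have c5 := dist_comm y z
  have c6 := dist_comm p z
  have c7 := dist_comm y w
  have c8 := dist_comm q w
  have c9 := dist_comm s y
  have c10 := dist_comm s z
  have c11 := dist_comm s u
  have c12 := dist_comm p s
  have c13 := dist_comm r u
  have c14 := dist_comm r s
  have c15 := dist_comm r w
  have c16 := dist_comm q x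
  have c17 := dist_comm q u
  have c18 := dist_comm u x
  have c19 := dist_comm y u
  have c20 := dist_comm y p
  have c21 := dist_comm w s
  -- rectangle identities
  have e1 : dist p x = dist y q := by linarith
  have e2 : dist p y = dist x q := by linarith
  have f1 : dist u p + dist p y = dist u y := by
    linarith [dist_triangle x u y, dist_triangle u p y]
  have f2 : dist u x + dist x q = dist u q := by
    linarith [dist_triangle p u q, dist_triangle u x q]
  have f3 : dist u z + dist z y = dist u y := by
    linarith [dist_triangle x u y, dist_triangle u z y]
  have f4 : dist w q = dist u x := by linarith
  have f5 : dist u w = dist p y := by linarith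
  have f6 : dist w y = dist u p := by linarith
  have f7 : dist p s = dist u z := by linarith
  have f8 : dist s z = dist p u := by linarith
  have f9 : dist u p + dist p s = dist u s := by
    linarith [dist_triangle u s y, dist_triangle u p s]
  -- distance from s to w
  have f10 : dist s y + dist y w = dist s w := by
    have : dist p y + dist y w = dist p w := by
      linarith [dist_triangle p w q, dist_triangle p y w]
    linarith [dist_triangle p s w, dist_triangle s y w]
  have f11 : dist u r = dist p s := by linarith
  have f12 : dist r s = dist p u := by linarith
  have f13 : dist p u + dist u w = dist p w := by
    linarith [dist_triangle p u w, dist_triangle p w q, dist_triangle p y w, dist_triangle u w q, dist_triangle p u q]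
  have f14 : dist p u + dist u r = dist p r := by
    linarith [dist_triangle p r w, dist_triangle p u r]
  have hzr : z = r := by
    apply corner_unique hmed (p := p) (u := u) (s := s) <;> rw [mI_iff] <;> linarith
  subst hzr
  have := dist_triangle p z q
  linarith [dist_triangle z w q, dist_triangle p u z]

/-- Intervals are convex. -/
theorem mI_convex (hmed : IsMedianSpace X) (a b : X) : MConvex (mInterval a b) := by
  intro x hx y hy z hz
  obtain ⟨p, p1, p2, p3⟩ := med_exists hmed a x y
  obtain ⟨q, q1, q2, q3⟩ := med_exists hmed b x y
  have hxq : q ∈ mInterval x b := mI_symm q1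
  have hyq : q ∈ mInterval y b := mI_symm q3
  -- a, p, x, q, b geodesic
  have hpx : x ∈ mInterval p b := mI_trans' hx p1
  have hpy : y ∈ mInterval p b := mI_trans' hy p3
  have hxpq : x ∈ mInterval p q := mI_symm (mI_trans' (mI_symm hpx) q1)
  have hypq : y ∈ mInterval p q := mI_symm (mI_trans' (mI_symm hpy) q3)
  have hzpq := rectangle_sub hmed p2 q2 hxpq hypq hz
  have hqpb : q ∈ mInterval p b := mI_symm (mI_trans (mI_symm hpx) q1)
  have hpab : p ∈ mInterval a b := mI_trans hx p1
  have hzpb : z ∈ mInterval p b := mI_trans hqpb hzpq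
  exact mI_symm (mI_trans (mI_symm hpab) (mI_symm hzpb))

/-- The median is a gate. -/
theorem mI_gate (hmed : IsMedianSpace X) {a b x g y : X} (g1 : g ∈ mInterval a b) (g2 : g ∈ mInterval b x)
    (g3 : g ∈ mInterval a x) (hy : y ∈ mInterval a b) : g ∈ mInterval x y := by
  obtain ⟨t, t1, t2, t3⟩ := med_exists hmed x y g
  have : t = g := med_unique hmed (a := a) (b := b) (c := x)
    (mI_convex hmed a b y hy g g1 t2)
    (mI_symm (mI_trans (mI_symm g2) t3)) (mI_symm (mI_trans (mI_symm g3) t3)) g1 g2 g3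
  exact this ▸ t1

/-- Shadows are convex. -/
theorem shadow_convex (hmed : IsMedianSpace X) (v t : X) : MConvex {y | t ∈ mInterval v y} := by
  intro y1 h1 y2 h2 y hy
  obtain ⟨e, e1, e2, e3⟩ := med_exists hmed t y1 y2
  have h1' : t ∈ mInterval v y1 := h1
  have h2' : t ∈ mInterval v y2 := h2
  have ev1 : e ∈ mInterval v y1 := mI_symm (mI_trans (mI_symm h1') (mI_symm e1))
  have ev2 : e ∈ mInterval v y2 := mI_symm (mI_trans (mI_symm h2') (mI_symm e3))
  have hg : e ∈ mInterval v y := mI_gate hmed e2 (mI_symm ev2) (mI_symm ev1) hy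
  have ht : t ∈ mInterval v e := mI_symm (mI_trans' (mI_symm h1') (mI_symm e1))
  exact mI_trans hg ht

/-- Peano property, explicit form. -/
theorem peano (hmed : IsMedianSpace X) {a b c u v w : X} (hu : u ∈ mInterval a b) (hv : v ∈ mInterval c u)
    (w2 : w ∈ mInterval c v) (w3 : w ∈ mInterval b v) :
    v ∈ mInterval a w := by
  obtain ⟨t, t1, t2, t3⟩ := med_exists hmed a w v
  have ta : t ∈ mInterval v a := mI_symm t3
  have tb : t ∈ mInterval v b := mI_trans (mI_symm w3) (mI_symm t2)
  have tc : t ∈ mInterval v c := mI_trans (mI_symm w2) (mI_symm t2)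
  have tu : t ∈ mInterval v u := shadow_convex hmed v t a ta b tb hu
  have h1 : v ∈ mInterval c t := mI_symm (mI_trans' (mI_symm hv) (mI_symm tu)) 
  have : t = v := mI_eq (mI_symm tc) h1
  exact this ▸ t1

theorem join_convex (hmed : IsMedianSpace X) {C : Set X} (hC : MConvex C) (p : X) :
    MConvex {y | ∃ c ∈ C, y ∈ mInterval c p} := by
  rintro s ⟨c, hc, hs⟩ t ⟨c', hc', ht⟩ z hz
  obtain ⟨w, w1, w2, w3⟩ := med_exists hmed p t z
  have hzw : z ∈ mInterval c w := peano hmed hs (mI_symm hz) w2 w3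
  have hwp : w ∈ mInterval p c' := mI_trans (mI_symm ht) w1
  obtain ⟨r, r1, r2, r3⟩ := med_exists hmed c' c z
  have hzr : z ∈ mInterval p r := peano hmed hwp hzw r2 r3
  exact ⟨r, hC c' hc' c hc r1, mI_symm hzr⟩

/-- Points are separated by halfspaces. -/
theorem exists_halfspace (hmed : IsMedianSpace X) {u v : X} (huv : u ≠ v) : ∃ h : Set X, IsHalfspace h ∧ u ∈ h ∧ v ∉ h := by
  obtain ⟨C, huC, hCmax⟩ := zorn_subset_nonempty {C : Set X | MConvex C ∧ v ∉ C} (by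
    intro c hc hch hne
    refine ⟨⋃₀ c, ⟨?_, ?_⟩, fun s hs => Set.subset_sUnion_of_mem hs⟩
    · rintro x ⟨s, hs, hx⟩ y ⟨t, ht, hy⟩ z hz
      rcases hch.total hs ht with h | h
      · exact ⟨t, ht, (hc ht).1 x (h hx) y hy hz⟩
      · exact ⟨s, hs, (hc hs).1 x hx y (h hy) hz⟩
    · rintro ⟨s, hs, hv⟩
      exact (hc hs).2 hv) {u} ⟨by
        intro x hx y hy z hz
        rw [Set.mem_singleton_iff] at *
        subst hx; subst hy
        rw [mI_iff] at hz
        have := dist_nonneg (x := y) (y := z)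
        have h2 := dist_comm y z
        rw [dist_self] at hz
        exact dist_le_zero.1 (by linarith), by simpa using huv.symm⟩
  have huC' : u ∈ C := huC rfl
  obtain ⟨hCc, hvC⟩ := hCmax.1
  have hjoin : ∀ p, p ∉ C → ∃ c ∈ C, v ∈ mInterval c p := by
    intro p hp
    by_contra hcon
    have hsub : C ⊆ {y | ∃ c ∈ C, y ∈ mInterval c p} := fun c hc => ⟨c, hc, mI_left _ _⟩
    exact hp (hCmax.2 ⟨join_convex hmed hCc p, hcon⟩ hsub ⟨u, huC', mI_right _ _⟩)
  refine ⟨C, ⟨hCc, ?_⟩, huC', hvC⟩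
  intro p hp q hq z hz hzC
  obtain ⟨c, hc, hvc⟩ := hjoin p hp
  obtain ⟨c', hc', hvc'⟩ := hjoin q hq
  obtain ⟨w, w1, w2, w3⟩ := med_exists hmed c' z v
  have hwC : w ∈ C := hCc c' hc' z hzC w1
  have hvqw : v ∈ mInterval w q := mI_trans' hvc' w3
  have hwp : w ∈ mInterval p v :=
    peano hmed hz (mI_symm w2) (mI_left v w) (mI_symm hvqw)
  have hvcw : v ∈ mInterval c w := mI_symm (mI_trans' (mI_symm hvc) hwp)
  exact hvC (hCc c hc w hwC hvcw)

end Median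

/-! ### Halfspaces separating two points -/

section Sep

variable {X : Type*} [MetricSpace X]

theorem transverse_of_incomparable {X : Type*} {b x : X} {h g : Set X} (hb : b ∈ h) (hx : x ∉ h)
    (gb : b ∈ g) (gx : x ∉ g) (h1 : ¬ h ⊆ g) (h2 : ¬ g ⊆ h) : TransverseSets h g := by
  obtain ⟨y, hy, hy'⟩ := Set.not_subset.1 h1
  obtain ⟨z, hz, hz'⟩ := Set.not_subset.1 h2
  exact ⟨⟨b, hb, gb⟩, ⟨z, hz', hz⟩, ⟨y, hy, hy'⟩, ⟨x, hx, gx⟩⟩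

/-- Rank bound, for finite sets of pairwise transverse halfspaces. -/
theorem card_le_of_rank {n : ℕ} (hrank : HasMedianRank X n) (t : Finset (Set X))
    (ht : ∀ h ∈ t, IsHalfspace h)
    (htr : ∀ h ∈ t, ∀ g ∈ t, h ≠ g → TransverseSets h g) : t.card ≤ n := by
  by_contra hcon
  push Not at hcon
  obtain ⟨t', ht', hc⟩ := Finset.exists_subset_card_eq (Nat.succ_le_of_lt hcon)
  let e := t'.equivFinOfCardEq hc
  refine hrank.2 ⟨fun i => (e.symm i : Set X), fun i => ht _ (ht' (e.symm i).2), ?_⟩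
  intro i j hij
  refine htr _ (ht' (e.symm i).2) _ (ht' (e.symm j).2) fun h => hij ?_
  exact e.symm.injective (Subtype.ext h)

/-- Union of a chain of halfspaces. -/
theorem sUnion_halfspace {c : Set (Set X)} (hc : ∀ h ∈ c, IsHalfspace h)
    (hch : ∀ h ∈ c, ∀ g ∈ c, h ⊆ g ∨ g ⊆ h) : IsHalfspace (⋃₀ c) := by
  refine ⟨?_, ?_⟩
  · rintro x ⟨s, hs, hx⟩ y ⟨t, ht, hy⟩ z hz
    rcases hch s hs t ht with h | h
    · exact ⟨t, ht, (hc t ht).1 x (h hx) y hy hz⟩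
    · exact ⟨s, hs, (hc s hs).1 x hx y (h hy) hz⟩
  · rintro x hx y hy z hz ⟨s, hs, hzs⟩
    exact (hc s hs).2 x (fun h => hx ⟨s, hs, h⟩) y (fun h => hy ⟨s, hs, h⟩) hz hzs

/-- Intersection of a chain of halfspaces. -/
theorem sInter_halfspace {c : Set (Set X)} (hc : ∀ h ∈ c, IsHalfspace h)
    (hch : ∀ h ∈ c, ∀ g ∈ c, h ⊆ g ∨ g ⊆ h) : IsHalfspace (⋂₀ c) := by
  refine ⟨?_, ?_⟩
  · intro x hx y hy z hz s hs
    exact (hc s hs).1 x (hx s hs) y (hy s hs) hz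
  · intro x hx y hy z hz hzc
    simp only [Set.mem_compl_iff, Set.mem_sInter, not_forall] at hx hy
    obtain ⟨s, hs, hx⟩ := hx
    obtain ⟨t, ht, hy⟩ := hy
    rcases hch s hs t ht with h | h
    · exact (hc s hs).2 x hx y (fun h' => hy (h h')) hz (hzc s hs)
    · exact (hc t ht).2 x (fun h' => hx (h h')) y hy hz (hzc t ht)

/-- Finite joins in an interval. -/
theorem exists_join (hmed : IsMedianSpace X) (b x : X) {ι : Type*} (y : ι → X) (s : Finset ι)
    (hy : ∀ i ∈ s, y i ∈ mInterval b x) :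
    ∃ j ∈ mInterval b x, (∀ i ∈ s, y i ∈ mInterval b j) ∧ dist b j ≤ ∑ i ∈ s, dist b (y i) := by
  classical
  induction s using Finset.induction_on with
  | empty => exact ⟨b, mI_left _ _, by simp, by simp⟩
  | insert i s hi ih =>
    obtain ⟨j, hj, hj1, hj2⟩ := ih fun k hk => hy k (Finset.mem_insert_of_mem hk)
    have hyi := hy i (Finset.mem_insert_self _ _)
    obtain ⟨m, m1, m2, m3⟩ := med_exists hmed (y i) j x
    have hmi : y i ∈ mInterval b m := mI_symm (mI_trans' (mI_symm hyi) (mI_symm m3))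
    have hmj : j ∈ mInterval b m := mI_symm (mI_trans' (mI_symm hj) (mI_symm m2))
    refine ⟨m, mI_symm (mI_trans (mI_symm hj) (mI_symm m2)), ?_, ?_⟩
    · intro k hk
      rcases Finset.mem_insert.1 hk with rfl | hk
      · exact hmi
      · exact mI_trans hmj (hj1 k hk)
    · rw [Finset.sum_insert hi]
      rw [mI_iff] at *
      have c1 := dist_comm j m
      have c2 := dist_comm b j
      have := dist_triangle (y i) b j
      have c3 := dist_comm b (y i)
      linarith

/-- Key lemma: a halfspace of depth at least `ε` at `b`. -/
theorem exists_deep_halfspace (hmed : IsMedianSpace X) {n : ℕ} (hrank : HasMedianRank X n)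
    (hn : 0 < n) (b x : X) (ε : ℝ) (hε : 0 < ε) (hd : n * ε ≤ dist b x) :
    ∃ h : Set X, IsHalfspace h ∧ b ∈ h ∧ x ∉ h ∧ ∀ y, y ∉ h → ε ≤ dist b y := by
  classical
  by_contra hcon
  push Not at hcon
  let P : Type _ := {h : Set X // IsHalfspace h ∧ b ∈ h ∧ x ∉ h}
  obtain ⟨c, hc⟩ := dilworth_infinite (α := P) n (by
    intro t hta
    have h := card_le_of_rank hrank (t.map (Function.Embedding.subtype _)) (by
      intro h hh
      obtain ⟨p, _, rfl⟩ := Finset.mem_map.1 hh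
      exact p.2.1) (by
      intro h hh g hg hne
      obtain ⟨p, hp, rfl⟩ := Finset.mem_map.1 hh
      obtain ⟨q, hq, rfl⟩ := Finset.mem_map.1 hg
      have hpq : p ≠ q := fun h => hne (by rw [h])
      exact transverse_of_incomparable p.2.2.1 p.2.2.2 q.2.2.1 q.2.2.2
        (fun h => hta hp hq hpq h) (fun h => hta hq hp hpq.symm h))
    simpa using h)
  have hex : ∀ i : Fin n, ∃ y ∈ mInterval b x, dist b y < ε ∧ ∀ p : P, c p = i → y ∉ p.1 := by
    intro i
    by_cases hne : ∃ p : P, c p = i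
    · obtain ⟨p0, hp0⟩ := hne
      let K : Set (Set X) := {h | ∃ p : P, c p = i ∧ p.1 = h}
      have hU : IsHalfspace (⋃₀ K) := by
        apply sUnion_halfspace
        · rintro h ⟨p, _, rfl⟩
          exact p.2.1
        · rintro h ⟨p, hp, rfl⟩ g ⟨q, hq, rfl⟩
          exact hc p q (hp.trans hq.symm)
      have hxU : x ∉ ⋃₀ K := by
        rintro ⟨_, ⟨p, _, rfl⟩, hx⟩
        exact p.2.2.2 hx
      obtain ⟨y, hy, hyd⟩ := hcon _ hU ⟨p0.1, ⟨p0, hp0, rfl⟩, p0.2.2.1⟩ hxU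
      obtain ⟨m, m1, m2, m3⟩ := med_exists hmed b y x
      refine ⟨m, m3, ?_, ?_⟩
      · rw [mI_iff] at m1
        linarith [dist_nonneg (x := m) (y := y)]
      · intro p hp hm
        exact hU.2 y hy x hxU m2 ⟨p.1, ⟨p, hp, rfl⟩, hm⟩
    · push Not at hne
      exact ⟨b, mI_left _ _, by simpa using hε, fun p hp => absurd hp (hne p)⟩
  choose y hyI hyd hyc using hex
  obtain ⟨j, hjI, hj1, hj2⟩ := exists_join hmed b x y Finset.univ (fun i _ => hyI i)
  have hlt : ∑ i, dist b (y i) < n * ε := by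
    have : ∑ i, dist b (y i) < ∑ _i : Fin n, ε := by
      apply Finset.sum_lt_sum_of_nonempty
      · exact ⟨⟨0, hn⟩, Finset.mem_univ _⟩
      · exact fun i _ => hyd i
    simpa using this
  have hjx : j ≠ x := by
    rintro rfl
    linarith
  obtain ⟨h, hh, hj, hx⟩ := exists_halfspace hmed hjx
  have hb : b ∈ h := by
    by_contra hb
    exact hh.2 b hb x hx hjI hj
  exact hyc _ ⟨h, hh, hb, hx⟩ rfl (hh.1 b hb j hj (hj1 _ (Finset.mem_univ _)))

end Sep

/-- In a complete connected median space of rank `n`, for distinct points `a ≠ b` and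
`0 < ε ≤ d(a,b)/n`, there are `k ≤ n` pairwise transverse halfspaces separating `b` from
`a`, each with `d(hᵢᶜ,b) ≥ ε`, whose intersection is at distance at least
`d(a,b) − n(n+1)ε/2` from `a`. -/
theorem statement12 (X : Type*) [MetricSpace X] [CompleteSpace X] [ConnectedSpace X]
    (hmed : IsMedianSpace X) (n : ℕ) (hrank : HasMedianRank X n)
    (a b : X) (hab : a ≠ b) (ε : ℝ) (hε : 0 < ε) (hεle : ε ≤ dist a b / n) :
    ∃ (k : ℕ), 1 ≤ k ∧ k ≤ n ∧ ∃ h : Fin k → Set X,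
      (∀ i, IsHalfspace (h i)) ∧ (∀ i j, i ≠ j → TransverseSets (h i) (h j)) ∧
      (∀ i, b ∈ h i ∧ a ∉ h i) ∧
      (∀ i, ε ≤ Metric.infDist b (h i)ᶜ) ∧
      dist a b - (n : ℝ) * (n + 1) / 2 * ε ≤ Metric.infDist a (⋂ i, h i) := by
  classical
  have hn : 0 < n := by
    rcases Nat.eq_zero_or_pos n with rfl | h
    · simp at hεle; linarith
    · exact h
  have hn' : (0 : ℝ) < n := by exact_mod_cast hn
  have hnε : n * ε ≤ dist a b := by
    rw [le_div_iff₀ hn'] at hεle; linarith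
  let H : Set (Set X) := {h | IsHalfspace h ∧ b ∈ h ∧ a ∉ h ∧ ∀ y, y ∉ h → ε ≤ dist b y}
  have hmin : ∀ h ∈ H, ∃ m, m ⊆ h ∧ Minimal (· ∈ H) m := by
    intro h hh
    refine zorn_superset_nonempty H ?_ h hh
    intro c hc hch hne
    refine ⟨⋂₀ c, ⟨?_, ?_, ?_, ?_⟩, fun s hs => Set.sInter_subset_of_mem hs⟩
    · exact sInter_halfspace (fun h hh => (hc hh).1) (fun h hh g hg => hch.total hh hg)
    · exact fun s hs => (hc hs).2.1
    · obtain ⟨s, hs⟩ := hne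
      exact fun ha => (hc hs).2.2.1 (ha s hs)
    · intro y hy
      simp only [Set.mem_sInter, not_forall] at hy
      obtain ⟨s, hs, hys⟩ := hy
      exact (hc hs).2.2.2 y hys
  let M : Set (Set X) := {m | Minimal (· ∈ H) m}
  have hMH : ∀ m ∈ M, m ∈ H := fun m hm => hm.1
  have hMt : ∀ h ∈ M, ∀ g ∈ M, h ≠ g → TransverseSets h g := by
    intro h hh g hg hne
    have h1 := hMH h hh
    have g1 := hMH g hg
    refine transverse_of_incomparable h1.2.1 h1.2.2.1 g1.2.1 g1.2.2.1 ?_ ?_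
    · intro hs
      exact hne (Set.Subset.antisymm hs (hg.2 h1 hs))
    · intro hs
      exact hne (Set.Subset.antisymm (hh.2 g1 hs) hs)
  have hcard : ∀ t : Finset (Set X), (t : Set (Set X)) ⊆ M → t.card ≤ n := fun t ht =>
    card_le_of_rank hrank t (fun h hh => (hMH h (ht hh)).1)
      (fun h hh g hg => hMt h (ht hh) g (ht hg))
  have hfin : M.Finite := by
    by_contra hinf
    obtain ⟨t, ht, htc⟩ := Set.Infinite.exists_subset_card_eq hinf (n + 1)
    have := hcard t ht
    omega
  let T := hfin.toFinset
  have hTM : ∀ h, h ∈ T ↔ h ∈ M := fun h => hfin.mem_toFinset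
  let e := T.equivFin
  have heM : ∀ i, (e.symm i : Set X) ∈ M := fun i => (hTM _).1 (e.symm i).2
  obtain ⟨h0, h01, h02, h03, h04⟩ := exists_deep_halfspace hmed hrank hn b a ε hε
    (by rw [dist_comm b a]; exact hnε)
  obtain ⟨m0, _, hm0⟩ := hmin h0 ⟨h01, h02, h03, h04⟩
  refine ⟨T.card, Finset.card_pos.2 ⟨m0, (hTM _).2 hm0⟩,
    hcard T (fun h hh => (hTM h).1 hh), fun i => (e.symm i : Set X),
    fun i => (hMH _ (heM i)).1, ?_, fun i => ⟨(hMH _ (heM i)).2.1, (hMH _ (heM i)).2.2.1⟩, ?_, ?_⟩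
  · intro i j hij
    exact hMt _ (heM i) _ (heM j) fun h => hij (e.symm.injective (Subtype.ext h))
  · intro i
    rw [Metric.le_infDist ⟨a, (hMH _ (heM i)).2.2.1⟩]
    exact fun {y} hy => (hMH _ (heM i)).2.2.2 y hy
  · rw [Metric.le_infDist ⟨b, Set.mem_iInter.2 fun i => (hMH _ (heM i)).2.1⟩]
    intro y hy
    rw [Set.mem_iInter] at hy
    obtain ⟨x, x1, x2, x3⟩ := med_exists hmed a b y
    have hxd : dist b x < n * ε := by
      by_contra hcon
      push Not at hcon
      obtain ⟨h, hh, hb, hx, hdeep⟩ := exists_deep_halfspace hmed hrank hn b x ε hε hcon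
      have ha : a ∉ h := fun ha => hx (hh.1 a ha b hb x1)
      obtain ⟨m, hmh, hm⟩ := hmin h ⟨hh, hb, ha, hdeep⟩
      have hym : y ∈ m := by
        have := hy (e ⟨m, (hTM m).2 hm⟩)
        simpa using this
      have hmH : m ∈ H := hm.1
      exact hx (hmh (hmH.1.1 b hmH.2.1 y hym x2))
    rw [mI_iff] at x1 x3
    have c1 := dist_comm b x
    have hn1 : (1 : ℝ) ≤ n := by exact_mod_cast hn
    have : (n : ℝ) * ε ≤ (n : ℝ) * (n + 1) / 2 * ε := by
      apply mul_le_mul_of_nonneg_right _ hε.le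
      nlinarith
    linarith [dist_nonneg (x := x) (y := y)]
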